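/- Let U_r be a deterministic N_r × n_r complex matrix, U_s a deterministic N_s × n_s complex matrix with U_sᴴ·U_s = I_{n_s}, and H(ω) = U_r · (Q ⊙ W(ω)) · U_sᴴ. Then the entrywise expectation of H·Hᴴ satisfies E[H·Hᴴ] = (Σ_{j ∈ Fin n_s} (v_s j)²) · U_r · diag(v_r⊙v_r) · U_rᴴ. -/

import Mathlib

open MeasureTheory Matrix
open scoped Matrix

/-- The entrywise integral commutes with multiplication by constant matrices on both sides. -/
theorem integral_mul_mul_apply {Ω l m n o : Type*} [Fintype m] [Fintype n]
    [MeasurableSpace Ω] {μ : Measure Ω} {X : Ω → Matrix m n ℂ}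
    (hX : ∀ i j, Integrable (fun ω => X ω i j) μ)
    (A : Matrix l m ℂ) (B : Matrix n o ℂ) (i : l) (k : o) :
    ∫ ω, (A * X ω * B) i k ∂μ = (A * (Matrix.of fun a b => ∫ ω, X ω a b ∂μ) * B) i k := by
  simp only [Matrix.mul_apply, Matrix.of_apply]
  have hAX : ∀ b, ∀ a ∈ Finset.univ, Integrable (fun ω => A i a * X ω a b) μ :=
    fun b a _ => (hX a b).const_mul _
  rw [integral_finsetSum _ fun b _ => (integrable_finsetSum _ (hAX b)).mul_const _]
  refine Finset.sum_congr rfl fun b _ => ?_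
  rw [integral_mul_const, integral_finsetSum _ (hAX b)]
  simp only [integral_const_mul]

theorem hadamard_mul_conjTranspose_apply {m n : Type*} [Fintype n]
    (Q W : Matrix m n ℂ) (a b : m) :
    ((Q ⊙ W) * (Q ⊙ W)ᴴ) a b =
      ∑ j, Q a j * star (Q b j) * (W a j * star (W b j)) := by
  simp only [Matrix.mul_apply, Matrix.hadamard_apply, Matrix.conjTranspose_apply, star_mul']
  exact Finset.sum_congr rfl fun j _ => by ring

theorem integrable_hadamard_gram_apply {Ω m n : Type*} [Fintype n]
    [MeasurableSpace Ω] {μ : Measure Ω} {W : Ω → Matrix m n ℂ}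
    (hint : ∀ i j k l, Integrable (fun ω => W ω i j * star (W ω k l)) μ)
    (Q : Matrix m n ℂ) (a b : m) :
    Integrable (fun ω => ((Q ⊙ W ω) * (Q ⊙ W ω)ᴴ) a b) μ := by
  simp only [hadamard_mul_conjTranspose_apply]
  exact integrable_finsetSum _ fun j _ => (hint a j b j).const_mul _

/-- The expected Gram matrix of `Q ⊙ W` with `W` white is diagonal. -/
theorem integral_hadamard_gram_of_white {Ω m n : Type*} [Fintype n] [DecidableEq m]
    [DecidableEq n] [MeasurableSpace Ω] {μ : Measure Ω} {W : Ω → Matrix m n ℂ}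
    (hint : ∀ i j k l, Integrable (fun ω => W ω i j * star (W ω k l)) μ)
    (hwhite : ∀ i j k l,
      ∫ ω, W ω i j * star (W ω k l) ∂μ = if (i, j) = (k, l) then 1 else 0)
    (Q : Matrix m n ℂ) :
    (Matrix.of fun a b => ∫ ω, ((Q ⊙ W ω) * (Q ⊙ W ω)ᴴ) a b ∂μ) =
      Matrix.diagonal fun a => ∑ j, Q a j * star (Q a j) := by
  ext a b
  simp only [Matrix.of_apply, hadamard_mul_conjTranspose_apply]
  rw [integral_finsetSum _ fun j _ => (hint a j b j).const_mul _]
  simp only [integral_const_mul, hwhite, Prod.mk.injEq, and_true]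
  obtain rfl | hab := eq_or_ne a b
  · simp
  · simp [hab]

/-- BS-side Gram expectation: for `H(ω) = U_r (Q ⊙ W(ω)) U_sᴴ` with `U_sᴴ U_s = I`,
`E[H Hᴴ] = (Σ_j (v_s j)²) · U_r diag(v_r⊙v_r) U_rᴴ` (expectation entrywise). -/
theorem gram_expectation_bs_side
    {Ω : Type*} [MeasurableSpace Ω] (μ : Measure Ω) [IsProbabilityMeasure μ]
    {n_r n_s N_r N_s : ℕ} (v_r : Fin n_r → ℝ) (v_s : Fin n_s → ℝ)
    (Q : Matrix (Fin n_r) (Fin n_s) ℂ)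
    (hQ : ∀ i j, Q i j = (v_r i : ℂ) * (v_s j : ℂ))
    (W : Ω → Matrix (Fin n_r) (Fin n_s) ℂ)
    (hmeas : ∀ i j, Measurable fun ω => W ω i j)
    (hint : ∀ i j k l, Integrable (fun ω => W ω i j * star (W ω k l)) μ)
    (hwhite : ∀ i j k l,
      ∫ ω, W ω i j * star (W ω k l) ∂μ = if (i, j) = (k, l) then 1 else 0)
    (U_r : Matrix (Fin N_r) (Fin n_r) ℂ) (U_s : Matrix (Fin N_s) (Fin n_s) ℂ)
    (hUs : U_sᴴ * U_s = 1)
    (H : Ω → Matrix (Fin N_r) (Fin N_s) ℂ)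
    (hH : ∀ ω, H ω = U_r * (Q ⊙ W ω) * U_sᴴ) :
    (Matrix.of fun i k => ∫ ω, (H ω * (H ω)ᴴ) i k ∂μ) =
      (∑ j, (v_s j : ℂ) ^ 2) •
        (U_r * Matrix.diagonal (fun i => (v_r i : ℂ) ^ 2) * U_rᴴ) := by
  have hgram : ∀ ω, H ω * (H ω)ᴴ = U_r * ((Q ⊙ W ω) * (Q ⊙ W ω)ᴴ) * U_rᴴ := fun ω => by
    rw [hH, Matrix.conjTranspose_mul, Matrix.conjTranspose_mul, Matrix.conjTranspose_conjTranspose,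
      Matrix.mul_assoc _ U_sᴴ, ← Matrix.mul_assoc U_sᴴ, hUs, Matrix.one_mul]
    simp only [Matrix.mul_assoc]
  have hdiag : (Matrix.diagonal fun i => ∑ j, Q i j * star (Q i j)) =
      (∑ j, (v_s j : ℂ) ^ 2) • Matrix.diagonal (fun i => (v_r i : ℂ) ^ 2) := by
    rw [← Matrix.diagonal_smul]
    congr 1
    ext i
    simp only [hQ, Pi.smul_apply, smul_eq_mul, Finset.sum_mul, star_mul', Complex.star_def,
      Complex.conj_ofReal]
    exact Finset.sum_congr rfl fun j _ => by ring
  ext i k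
  simp only [Matrix.of_apply, hgram]
  rw [integral_mul_mul_apply (integrable_hadamard_gram_apply hint Q),
    integral_hadamard_gram_of_white hint hwhite, hdiag, Matrix.mul_smul, Matrix.smul_mul]
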